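/- Let σ : F → F be the map, semilinear with respect to the field automorphism of ℚ(q) sending q to −q^{−1}, defined on basis words by σ(i₁,…,i_d) = (−1)^{Σ_{s<t} p(i_s)p(i_t)} q^{−Σ_{s<t}(α_{i_s},α_{i_t})} (i₁,…,i_d). Then σ(x ⋄ y) = σ(y) ⋄ σ(x) for all x, y ∈ F, and σ(𝐢) = (−1)^{P(𝐢)} q^{−N(|𝐢|)} 𝐢 for every word 𝐢. -/

import Mathlib

namespace SpinQHA

/-- The coefficient field `ℚ(q)`. -/
abbrev Kq : Type := RatFunc ℚ

/-- The variable `q`. -/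
noncomputable def qX : Kq := RatFunc.X

/-- Parity of the letter `i` (alphabet `Fin (n+2)`, last letter odd). -/
def pa (n : ℕ) (i : Fin (n+2)) : ℕ := if (i : ℕ) = n+1 then 1 else 0

/-- Symmetrized Cartan matrix of `osp(1|2(n+2))`. -/
def cart (n : ℕ) (i j : Fin (n+2)) : ℤ :=
  if i = j then (if (i : ℕ) = n+1 then 2 else 4)
  else if (i : ℕ) + 1 = (j : ℕ) ∨ (j : ℕ) + 1 = (i : ℕ) then -2 else 0

/-- Bilinear form on `Q⁺`. -/
def bil (n : ℕ) (μ ν : Fin (n+2) → ℕ) : ℤ :=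
  ∑ i, ∑ j, (μ i : ℤ) * (ν j : ℤ) * cart n i j

/-- Weight of a word. -/
def wt (n : ℕ) (w : List (Fin (n+2))) : Fin (n+2) → ℕ := fun i => w.count i

/-- Parity (as a natural number, read mod 2) of a word. -/
def pw (n : ℕ) (w : List (Fin (n+2))) : ℕ := (w.map (pa n)).sum

/-- `F`, the free `ℚ(q)`-module on the set of words. -/
abbrev F (n : ℕ) : Type := List (Fin (n+2)) →₀ Kq

/-- Quantum shuffle of two words in the reversed representation, encoding
`(xi) ⋄ (yj) = (x ⋄ (yj))i + (-1)^{p(xi)p(j)} q^{-(|xi|,|j|)} ((xi) ⋄ y)j`. -/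
noncomputable def shAux (n : ℕ) : List (Fin (n+2)) → List (Fin (n+2)) → F n
  | [], y => Finsupp.single y 1
  | x, [] => Finsupp.single x 1
  | i :: x, j :: y =>
      Finsupp.mapDomain (List.cons i) (shAux n x (j :: y))
      + ((-1 : Kq) ^ (pw n (i :: x) * pa n j)
          * qX ^ (-(bil n (wt n (i :: x)) (wt n [j])))) •
          Finsupp.mapDomain (List.cons j) (shAux n (i :: x) y)
  termination_by x y => x.length + y.length

/-- Quantum shuffle product of two words. -/
noncomputable def shw (n : ℕ) (x y : List (Fin (n+2))) : F n :=
  Finsupp.mapDomain List.reverse (shAux n x.reverse y.reverse)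

/-- The quantum shuffle product `⋄` on `F`, extended bilinearly. -/
noncomputable def diam (n : ℕ) (u v : F n) : F n :=
  u.sum fun x cx => v.sum fun y cy => (cx * cy) • shw n x y

/-- `pairSum f (i₁,…,i_d) = Σ_{s<t} f i_s i_t`. -/
def pairSum {α M : Type*} [AddCommMonoid M] (f : α → α → M) : List α → M
  | [] => 0
  | a :: l => (l.map (f a)).sum + pairSum f l

/-- `N(ν) = ((ν,ν) - Σᵢ cᵢ(αᵢ,αᵢ))/2`. -/
def Nf (n : ℕ) (ν : Fin (n+2) → ℕ) : ℤ :=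
  (bil n ν ν - ∑ i, (ν i : ℤ) * cart n i i) / 2

/-- `P(ν) = m(m-1)/2` where `m = Σᵢ cᵢ p(i)`; for a word `w` the relevant `m` is
its parity-count `pw`. -/
def Pw (n : ℕ) (w : List (Fin (n+2))) : ℕ := pw n w * (pw n w - 1) / 2

/-- The map `σ_φ : F → F`, semilinear with respect to `φ`, defined on basis words by
`σ(i₁,…,i_d) = (-1)^{Σ_{s<t} p(i_s)p(i_t)} q^{-Σ_{s<t}(α_{i_s},α_{i_t})} (i₁,…,i_d)`. -/
noncomputable def sigmaMap (n : ℕ) (φ : Kq →+* Kq) (u : F n) : F n :=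
  u.sum fun w c =>
    Finsupp.single w (φ c *
      ((-1 : Kq) ^ (pairSum (fun a b => pa n a * pa n b) w)
        * qX ^ (-(pairSum (fun a b => cart n a b) w))))

theorem wt_cons (n : ℕ) (a : Fin (n+2)) (w : List (Fin (n+2))) :
    wt n (a :: w) = wt n [a] + wt n w := by
  funext i
  simp [wt, List.count_cons, add_comm]

theorem wt_nil (n : ℕ) : wt n [] = 0 := by
  funext i
  simp [wt]

theorem pw_cons (n : ℕ) (a : Fin (n+2)) (w : List (Fin (n+2))) :
    pw n (a :: w) = pa n a + pw n w := by
  simp [pw]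

theorem cart_comm (n : ℕ) (i j : Fin (n+2)) : cart n i j = cart n j i := by
  unfold cart
  grind

theorem even_cart (n : ℕ) (i j : Fin (n+2)) : Even (cart n i j) := by
  unfold cart
  split_ifs <;> decide

theorem bil_add_left (n : ℕ) (μ μ' ν : Fin (n+2) → ℕ) :
    bil n (μ + μ') ν = bil n μ ν + bil n μ' ν := by
  simp [bil, add_mul, Finset.sum_add_distrib]

theorem bil_comm (n : ℕ) (μ ν : Fin (n+2) → ℕ) : bil n μ ν = bil n ν μ := by
  unfold bil
  rw [Finset.sum_comm]
  refine Finset.sum_congr rfl fun i _ => Finset.sum_congr rfl fun j _ => ?_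
  rw [cart_comm]
  ring

theorem bil_add_right (n : ℕ) (μ ν ν' : Fin (n+2) → ℕ) :
    bil n μ (ν + ν') = bil n μ ν + bil n μ ν' := by
  rw [bil_comm, bil_add_left, bil_comm n ν, bil_comm n ν']

theorem even_bil (n : ℕ) (μ ν : Fin (n+2) → ℕ) : Even (bil n μ ν) :=
  Finset.even_sum _ fun i _ => Finset.even_sum _ fun j _ => (even_cart n i j).mul_left _

theorem bil_zero_right (n : ℕ) (μ : Fin (n+2) → ℕ) : bil n μ 0 = 0 := by
  simp [bil]

theorem wt_singleton (n : ℕ) (a : Fin (n+2)) : wt n [a] = Pi.single a 1 := by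
  funext i
  by_cases h : i = a
  · simp [wt, h]
  · simp [wt, h, Ne.symm h]

theorem bil_singleton (n : ℕ) (a b : Fin (n+2)) : bil n (wt n [a]) (wt n [b]) = cart n a b := by
  simp [bil, wt_singleton, Pi.single_apply]

theorem bil_singleton_wt (n : ℕ) (a : Fin (n+2)) (w : List (Fin (n+2))) :
    bil n (wt n [a]) (wt n w) = (w.map (cart n a)).sum := by
  induction w with
  | nil => simp [wt_nil, bil_zero_right]
  | cons b w ih => rw [wt_cons n b, bil_add_right, ih, bil_singleton, List.map_cons, List.sum_cons]

theorem qX_ne_zero : qX ≠ 0 := RatFunc.X_ne_zero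

/-- The braiding factor `(-1)^{p(x)p(y)} q^{-(|x|,|y|)}` of two words. -/
noncomputable def braiding (n : ℕ) (x y : List (Fin (n+2))) : Kq :=
  (-1) ^ (pw n x * pw n y) * qX ^ (-(bil n (wt n x) (wt n y)))

theorem braiding_ne_zero (n : ℕ) (x y : List (Fin (n+2))) : braiding n x y ≠ 0 :=
  mul_ne_zero (pow_ne_zero _ (neg_ne_zero.mpr one_ne_zero)) (zpow_ne_zero _ qX_ne_zero)

theorem braiding_comm (n : ℕ) (x y : List (Fin (n+2))) : braiding n x y = braiding n y x := by
  rw [braiding, braiding, bil_comm, mul_comm (pw n x)]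

theorem braiding_cons_left (n : ℕ) (a : Fin (n+2)) (x y : List (Fin (n+2))) :
    braiding n (a :: x) y = braiding n [a] y * braiding n x y := by
  have h : pw n [a] = pa n a := by simp [pw]
  simp only [braiding]
  rw [wt_cons n a x, bil_add_left, pw_cons, h, add_mul, pow_add, neg_add, zpow_add₀ qX_ne_zero]
  ring

theorem braiding_cons_right (n : ℕ) (a : Fin (n+2)) (x y : List (Fin (n+2))) :
    braiding n x (a :: y) = braiding n x [a] * braiding n x y := by
  rw [braiding_comm, braiding_cons_left, braiding_comm n [a], braiding_comm n y]

theorem braiding_nil_right (n : ℕ) (x : List (Fin (n+2))) : braiding n x [] = 1 := by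
  simp [braiding, wt_nil, bil_zero_right, pw]

theorem braiding_nil_left (n : ℕ) (x : List (Fin (n+2))) : braiding n [] x = 1 := by
  rw [braiding_comm, braiding_nil_right]

theorem map_braiding (n : ℕ) (φ : Kq →+* Kq) (hφ : φ RatFunc.X = -RatFunc.X⁻¹)
    (x y : List (Fin (n+2))) : φ (braiding n x y) = (braiding n x y)⁻¹ := by
  have hq : φ qX = -qX⁻¹ := hφ
  rw [braiding, map_mul, map_pow, map_neg, map_one, map_zpow₀, hq,
    (even_bil n (wt n x) (wt n y)).neg.neg_zpow, inv_zpow, mul_inv, ← inv_pow, inv_neg, inv_one]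

theorem shAux_nil_right (n : ℕ) (x : List (Fin (n+2))) :
    shAux n x [] = Finsupp.single x 1 := by
  cases x <;> simp [shAux]

theorem shAux_cons_cons (n : ℕ) (i j : Fin (n+2)) (x y : List (Fin (n+2))) :
    shAux n (i :: x) (j :: y) = Finsupp.mapDomain (List.cons i) (shAux n x (j :: y))
      + braiding n (i :: x) [j] • Finsupp.mapDomain (List.cons j) (shAux n (i :: x) y) := by
  have h : pw n [j] = pa n j := by simp [pw]
  rw [shAux, braiding, h]

theorem mapDomain_cons_nil {α M : Type*} [AddCommMonoid M] (i : α) (f : List α →₀ M) :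
    Finsupp.mapDomain (List.cons i) f [] = 0 :=
  Finsupp.mapDomain_of_notMem_range _ _ (by simp)

theorem mapDomain_cons_cons {α M : Type*} [DecidableEq α] [AddCommMonoid M] (i k : α)
    (f : List α →₀ M) (w : List α) :
    Finsupp.mapDomain (List.cons i) f (k :: w) = if k = i then f w else 0 := by
  split_ifs with h
  · subst h
    exact Finsupp.mapDomain_apply (List.cons_injective) _ _
  · exact Finsupp.mapDomain_of_notMem_range _ _ (by simp [Ne.symm h])

/-- Up to the braiding factor, conjugating coefficients swaps the two factors of a shuffle. -/
theorem map_shAux_mul_braiding (n : ℕ) (φ : Kq →+* Kq) (hφ : φ RatFunc.X = -RatFunc.X⁻¹)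
    (x y w : List (Fin (n+2))) :
    φ (shAux n x y w) * braiding n x y = shAux n y x w := by
  induction x generalizing y w with
  | nil =>
    rw [shAux_nil_right, shAux, braiding_nil_left, Finsupp.single_apply]
    split_ifs <;> simp
  | cons i x ihx =>
    induction y generalizing w with
    | nil =>
      rw [shAux_nil_right, shAux, braiding_nil_right, Finsupp.single_apply]
      split_ifs <;> simp
    | cons j y ihy =>
      rw [shAux_cons_cons, shAux_cons_cons]
      cases w with
      | nil => simp [mapDomain_cons_nil]
      | cons k w =>
        simp only [Finsupp.add_apply, Finsupp.smul_apply, mapDomain_cons_cons, smul_eq_mul,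
          map_add, map_mul, map_braiding n φ hφ]
        have h₁ : φ (if k = i then shAux n x (j :: y) w else 0) * braiding n (i :: x) (j :: y)
            = braiding n (j :: y) [i] * if k = i then shAux n (j :: y) x w else 0 := by
          split_ifs
          · rw [braiding_cons_left, ← ihx, braiding_comm n [i]]
            ring
          · simp
        have h₂ : (braiding n (i :: x) [j])⁻¹ * φ (if k = j then shAux n (i :: x) y w else 0)
            * braiding n (i :: x) (j :: y) = if k = j then shAux n y (i :: x) w else 0 := by
          have hb := braiding_ne_zero n (i :: x) [j]
          split_ifs
          · rw [braiding_cons_right n j _ y, ← ihy]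
            field_simp
          · simp
        rw [add_mul, h₁, h₂, add_comm]

theorem perm_of_shAux_ne_zero (n : ℕ) (x y w : List (Fin (n+2))) (h : shAux n x y w ≠ 0) :
    w.Perm (x ++ y) := by
  induction x generalizing y w with
  | nil =>
    rw [shAux, Finsupp.single_apply] at h
    simp_all
  | cons i x ihx =>
    induction y generalizing w with
    | nil =>
      rw [shAux_nil_right, Finsupp.single_apply] at h
      simp_all
    | cons j y ihy =>
      rw [shAux_cons_cons] at h
      cases w with
      | nil => simp [mapDomain_cons_nil] at h
      | cons k w =>
        simp only [Finsupp.add_apply, Finsupp.smul_apply, mapDomain_cons_cons, smul_eq_mul] at h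
        by_cases h₁ : k = i ∧ shAux n x (j :: y) w ≠ 0
        · obtain ⟨rfl, h₁⟩ := h₁
          exact (ihx _ _ h₁).cons _
        · by_cases h₂ : k = j ∧ shAux n (i :: x) y w ≠ 0
          · obtain ⟨rfl, h₂⟩ := h₂
            exact ((ihy _ h₂).cons _).trans List.perm_middle.symm
          · grind

/-- The scalar `(-1)^{Σ_{s<t} p(i_s)p(i_t)} q^{-Σ_{s<t}(α_{i_s},α_{i_t})}` by which `sigmaMap`
scales a word. -/
noncomputable def sigmaCoeff (n : ℕ) (w : List (Fin (n+2))) : Kq :=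
  (-1 : Kq) ^ (pairSum (fun a b => pa n a * pa n b) w)
    * qX ^ (-(pairSum (fun a b => cart n a b) w))

theorem sigmaCoeff_nil (n : ℕ) : sigmaCoeff n [] = 1 := by
  simp [sigmaCoeff, pairSum]

theorem sigmaCoeff_cons (n : ℕ) (a : Fin (n+2)) (w : List (Fin (n+2))) :
    sigmaCoeff n (a :: w) = braiding n [a] w * sigmaCoeff n w := by
  have h : pw n [a] = pa n a := by simp [pw]
  rw [sigmaCoeff, pairSum, pairSum, List.sum_map_mul_left, braiding, bil_singleton_wt, h,
    sigmaCoeff, pow_add, neg_add, zpow_add₀ qX_ne_zero, pw]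
  ring

theorem sigmaCoeff_append (n : ℕ) (x y : List (Fin (n+2))) :
    sigmaCoeff n (x ++ y) = sigmaCoeff n x * sigmaCoeff n y * braiding n x y := by
  have braiding_append (a : Fin (n+2)) (x : List (Fin (n+2))) :
      braiding n [a] (x ++ y) = braiding n [a] x * braiding n [a] y := by
    induction x with
    | nil => simp [braiding_nil_right]
    | cons b x ih =>
      rw [List.cons_append, braiding_cons_right, ih, braiding_cons_right n b [a] x, mul_assoc]
  induction x with
  | nil => simp [sigmaCoeff_nil, braiding_nil_left]
  | cons a x ih =>
    rw [List.cons_append, sigmaCoeff_cons, ih, braiding_append, sigmaCoeff_cons n a x,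
      braiding_cons_left n a x]
    ring

theorem braiding_perm_right (n : ℕ) (x : List (Fin (n+2))) {y y' : List (Fin (n+2))}
    (h : y.Perm y') : braiding n x y = braiding n x y' := by
  have hw : wt n y = wt n y' := funext fun i => h.count_eq i
  have hp : pw n y = pw n y' := (h.map _).sum_eq
  rw [braiding, braiding, hw, hp]

theorem sigmaCoeff_perm (n : ℕ) {w w' : List (Fin (n+2))} (h : w.Perm w') :
    sigmaCoeff n w = sigmaCoeff n w' := by
  induction h with
  | nil => rfl
  | cons a h ih => rw [sigmaCoeff_cons, sigmaCoeff_cons, ih, braiding_perm_right n _ h]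
  | swap a b l =>
    rw [sigmaCoeff_cons, sigmaCoeff_cons, sigmaCoeff_cons, sigmaCoeff_cons, braiding_cons_right,
      braiding_cons_right n b [a], braiding_comm n [b] [a]]
    ring
  | trans _ _ ih₁ ih₂ => exact ih₁.trans ih₂

theorem shw_apply (n : ℕ) (x y w : List (Fin (n+2))) :
    shw n x y w = shAux n x.reverse y.reverse w.reverse := by
  conv_lhs => rw [shw, ← List.reverse_reverse w]
  exact Finsupp.mapDomain_apply List.reverse_injective _ _

theorem map_shw_mul_sigmaCoeff (n : ℕ) (φ : Kq →+* Kq) (hφ : φ RatFunc.X = -RatFunc.X⁻¹)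
    (x y w : List (Fin (n+2))) :
    φ (shw n x y w) * sigmaCoeff n w = sigmaCoeff n y * sigmaCoeff n x * shw n y x w := by
  rw [shw_apply, shw_apply, ← map_shAux_mul_braiding n φ hφ x.reverse]
  by_cases h : shAux n x.reverse y.reverse w.reverse = 0
  · simp [h]
  · rw [← sigmaCoeff_perm n (List.reverse_perm w),
      sigmaCoeff_perm n (perm_of_shAux_ne_zero n _ _ _ h), sigmaCoeff_append,
      sigmaCoeff_perm n (List.reverse_perm x), sigmaCoeff_perm n (List.reverse_perm y)]
    ring

theorem sigmaMap_apply (n : ℕ) (φ : Kq →+* Kq) (u : F n) (w : List (Fin (n+2))) :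
    sigmaMap n φ u w = φ (u w) * sigmaCoeff n w := by
  change (u.sum fun v c => Finsupp.single v (φ c * sigmaCoeff n v)) w = _
  rw [Finsupp.sum_apply, Finsupp.sum_eq_single w]
  · simp
  · intro v _ hv
    simp [hv]
  · simp

theorem sigmaMap_zero (n : ℕ) (φ : Kq →+* Kq) : sigmaMap n φ 0 = 0 := by
  ext w
  simp [sigmaMap_apply]

theorem sigmaMap_add (n : ℕ) (φ : Kq →+* Kq) (u v : F n) :
    sigmaMap n φ (u + v) = sigmaMap n φ u + sigmaMap n φ v := by
  ext w
  simp [sigmaMap_apply, add_mul]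

theorem sigmaMap_single (n : ℕ) (φ : Kq →+* Kq) (w : List (Fin (n+2))) (c : Kq) :
    sigmaMap n φ (Finsupp.single w c) = Finsupp.single w (φ c * sigmaCoeff n w) := by
  ext v
  rw [sigmaMap_apply, Finsupp.single_apply, Finsupp.single_apply]
  split_ifs with h <;> simp [h]

theorem diam_zero_left (n : ℕ) (v : F n) : diam n 0 v = 0 := by
  simp [diam]

theorem diam_zero_right (n : ℕ) (u : F n) : diam n u 0 = 0 := by
  simp [diam]

theorem diam_add_left (n : ℕ) (u u' v : F n) :
    diam n (u + u') v = diam n u v + diam n u' v := by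
  unfold diam
  refine Finsupp.sum_add_index' (by simp) fun x c c' => ?_
  simp [Finsupp.sum, add_mul, add_smul, Finset.sum_add_distrib]

theorem diam_add_right (n : ℕ) (u v v' : F n) :
    diam n u (v + v') = diam n u v + diam n u v' := by
  unfold diam
  rw [← Finsupp.sum_add]
  refine Finsupp.sum_congr fun x _ => Finsupp.sum_add_index' (by simp) fun y c c' => ?_
  rw [mul_add, add_smul]

theorem diam_single_single (n : ℕ) (x y : List (Fin (n+2))) (a b : Kq) :
    diam n (Finsupp.single x a) (Finsupp.single y b) = (a * b) • shw n x y := by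
  simp [diam]

theorem sigmaMap_diam (n : ℕ) (φ : Kq →+* Kq) (hφ : φ RatFunc.X = -RatFunc.X⁻¹) (x y : F n) :
    sigmaMap n φ (diam n x y) = diam n (sigmaMap n φ y) (sigmaMap n φ x) := by
  induction x using Finsupp.induction_linear with
  | zero => simp [diam_zero_left, diam_zero_right, sigmaMap_zero]
  | add x x' hx hx' => rw [diam_add_left, sigmaMap_add, hx, hx', sigmaMap_add, diam_add_right]
  | single x a =>
    induction y using Finsupp.induction_linear with
    | zero => simp [diam_zero_left, diam_zero_right, sigmaMap_zero]
    | add y y' hy hy' => rw [diam_add_right, sigmaMap_add, hy, hy', sigmaMap_add, diam_add_left]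
    | single y b =>
      rw [diam_single_single, sigmaMap_single, sigmaMap_single, diam_single_single]
      ext w
      rw [sigmaMap_apply, Finsupp.smul_apply, Finsupp.smul_apply, smul_eq_mul, smul_eq_mul,
        map_mul, map_mul, mul_assoc, map_shw_mul_sigmaCoeff n φ hφ]
      ring

theorem pairSum_cart (n : ℕ) (w : List (Fin (n+2))) :
    pairSum (fun a b => cart n a b) w = Nf n (wt n w) := by
  have h : bil n (wt n w) (wt n w) - ∑ i, (wt n w i : ℤ) * cart n i i
      = 2 * pairSum (fun a b => cart n a b) w := by
    induction w with
    | nil => simp [wt_nil, bil_zero_right, pairSum]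
    | cons a w ih =>
      have hd : ∑ i, (wt n (a :: w) i : ℤ) * cart n i i
          = cart n a a + ∑ i, (wt n w i : ℤ) * cart n i i := by
        rw [wt_cons, wt_singleton]
        simp [add_mul, Finset.sum_add_distrib, Pi.single_apply]
      rw [hd, wt_cons, bil_add_left, bil_add_right, bil_add_right, bil_singleton,
        bil_comm n (wt n w) (wt n [a]), bil_singleton_wt, pairSum]
      linarith
  rw [Nf, h, Int.mul_ediv_cancel_left _ two_ne_zero]

theorem pairSum_pa (n : ℕ) (w : List (Fin (n+2))) :
    pairSum (fun a b => pa n a * pa n b) w = Pw n w := by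
  have h : pw n w * pw n w = pw n w + 2 * pairSum (fun a b => pa n a * pa n b) w := by
    induction w with
    | nil => simp [pw, pairSum]
    | cons a w ih =>
      have ha : pa n a * pa n a = pa n a := by
        unfold pa
        split_ifs <;> rfl
      rw [pw_cons, pairSum, List.sum_map_mul_left, ← pw]
      linarith
  rw [Pw, Nat.mul_sub_one, h, Nat.add_sub_cancel_left, Nat.mul_div_cancel_left _ two_pos]

/-- For `σ` semilinear over the automorphism `q ↦ -q⁻¹` of `ℚ(q)`:
`σ(x ⋄ y) = σ(y) ⋄ σ(x)` for all `x, y ∈ F`, and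
`σ(𝐢) = (-1)^{P(𝐢)} q^{-N(|𝐢|)} 𝐢` for every word `𝐢`. -/
theorem stmt4 (n : ℕ) (φ : Kq →+* Kq) (hφ : φ RatFunc.X = -RatFunc.X⁻¹) :
    (∀ x y : F n, sigmaMap n φ (diam n x y) = diam n (sigmaMap n φ y) (sigmaMap n φ x)) ∧
    (∀ w : List (Fin (n+2)),
      sigmaMap n φ (Finsupp.single w 1)
        = ((-1 : Kq) ^ (Pw n w) * qX ^ (-(Nf n (wt n w)))) • Finsupp.single w 1) := by
  refine ⟨sigmaMap_diam n φ hφ, fun w => ?_⟩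
  rw [sigmaMap_single, map_one, one_mul, sigmaCoeff, pairSum_cart, pairSum_pa,
    Finsupp.smul_single, smul_eq_mul, mul_one]

end SpinQHA
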